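/- Let ε ∈ (0, 1/2] and let (a, b) ∈ ℝ². Then the function h(λ) = (1/2)(q(λε) − a)² + (1/2)(q(1 − (1 − λ)ε) − b)² is strictly convex on the (convex) set {λ ∈ (0,1) : q(λε) ≤ a and q(1 − (1 − λ)ε) ≥ b}. (Consequently, the orthogonal projection of a point onto S_ε can be computed by solving a one-dimensional strictly convex minimization problem over the boundary parameterization.) -/

import Mathlib

open MeasureTheory ProbabilityTheory Set

/-- The standard Gaussian CDF. -/
noncomputable def Phi (t : ℝ) : ℝ := ((gaussianReal 0 1) (Set.Iic t)).toReal

lemma gaussianPDFReal_zero_one (x : ℝ) :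
    gaussianPDFReal 0 1 x = (√(2 * Real.pi))⁻¹ * Real.exp (-x ^ 2 / 2) := by
  simp [gaussianPDFReal]

lemma continuous_gaussianPDFReal_zero_one : Continuous (gaussianPDFReal 0 1) := by
  rw [funext gaussianPDFReal_zero_one]
  fun_prop

lemma Phi_eq_setIntegral (t : ℝ) : Phi t = ∫ x in Iic t, gaussianPDFReal 0 1 x := by
  rw [Phi, gaussianReal_apply_eq_integral _ one_ne_zero, ENNReal.toReal_ofReal]
  exact integral_nonneg fun x => gaussianPDFReal_nonneg 0 1 x

lemma hasDerivAt_Phi (t : ℝ) : HasDerivAt Phi (gaussianPDFReal 0 1 t) t := by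
  have hint := integrable_gaussianPDFReal 0 1
  have h : Phi = fun t => Phi 0 + ∫ x in (0 : ℝ)..t, gaussianPDFReal 0 1 x := by
    funext s
    rw [← intervalIntegral.integral_Iic_sub_Iic hint.integrableOn hint.integrableOn,
      ← Phi_eq_setIntegral, ← Phi_eq_setIntegral]
    ring
  rw [h]
  exact (continuous_gaussianPDFReal_zero_one.integral_hasStrictDerivAt 0 t).hasDerivAt.const_add _

lemma strictMono_Phi : StrictMono Phi :=
  strictMono_of_deriv_pos fun t => by
    rw [(hasDerivAt_Phi t).deriv]
    exact gaussianPDFReal_pos 0 1 t one_ne_zero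

lemma strictConvexOn_Phi : StrictConvexOn ℝ (Iic 0) Phi := by
  refine StrictMonoOn.strictConvexOn_of_deriv (convex_Iic 0)
    (fun t _ => (hasDerivAt_Phi t).continuousAt.continuousWithinAt) ?_
  rw [interior_Iic]
  intro x hx y hy hxy
  rw [(hasDerivAt_Phi x).deriv, (hasDerivAt_Phi y).deriv, gaussianPDFReal_zero_one,
    gaussianPDFReal_zero_one]
  have hx : x < 0 := hx
  have hy : y < 0 := hy
  gcongr 2
  nlinarith

lemma Phi_neg (t : ℝ) : Phi (-t) = 1 - Phi t := by
  have := nullSingletonClass_gaussianReal (μ := 0) (v := 1) one_ne_zero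
  have h : gaussianReal 0 1 (Iic (-t)) = gaussianReal 0 1 (Ioi t) := by
    have hmap := gaussianReal_map_neg (μ := 0) (v := 1)
    rw [neg_zero] at hmap
    nth_rewrite 1 [← hmap]
    rw [Measure.map_apply measurable_neg measurableSet_Iic]
    simp [Ioi_ae_eq_Ici.symm.measure_eq]
  have hc := prob_compl_eq_one_sub (μ := gaussianReal 0 1) (measurableSet_Iic (a := t))
  rw [compl_Iic] at hc
  rw [Phi, Phi, h, hc, ENNReal.toReal_sub_of_le prob_le_one ENNReal.one_ne_top,
    ENNReal.toReal_one]

lemma Phi_zero : Phi 0 = 1 / 2 := by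
  have h := Phi_neg 0
  rw [neg_zero] at h
  linarith

section Quantile

variable {q : ℝ → ℝ}

lemma strictMonoOn_quantile (hq : ∀ p ∈ Ioo (0 : ℝ) 1, Phi (q p) = p) :
    StrictMonoOn q (Ioo 0 1) := fun x hx y hy hxy =>
  strictMono_Phi.lt_iff_lt.1 (by rwa [hq x hx, hq y hy])

lemma quantile_one_sub (hq : ∀ p ∈ Ioo (0 : ℝ) 1, Phi (q p) = p) {p : ℝ}
    (hp : p ∈ Ioo (0 : ℝ) 1) : q (1 - p) = -q p := by
  apply strictMono_Phi.injective
  rw [Phi_neg, hq p hp, hq (1 - p) ⟨by linarith [hp.2], by linarith [hp.1]⟩]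

lemma strictConcaveOn_quantile (hq : ∀ p ∈ Ioo (0 : ℝ) 1, Phi (q p) = p) :
    StrictConcaveOn ℝ (Ioo 0 (1 / 2)) q := by
  have hsub : Ioo (0 : ℝ) (1 / 2) ⊆ Ioo 0 1 := Ioo_subset_Ioo_right (by norm_num)
  have hneg : ∀ p ∈ Ioo (0 : ℝ) (1 / 2), q p ∈ Iic (0 : ℝ) := fun p hp =>
    strictMono_Phi.le_iff_le.1 (by rw [hq p (hsub hp), Phi_zero]; exact hp.2.le)
  refine ⟨convex_Ioo _ _, fun x hx y hy hxy s t hs ht hst => ?_⟩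
  have hne : q x ≠ q y := (strictMonoOn_quantile hq).injOn.ne (hsub hx) (hsub hy) hxy
  have h := strictConvexOn_Phi.2 (hneg x hx) (hneg y hy) hne hs ht hst
  rw [hq x (hsub hx), hq y (hsub hy)] at h
  apply strictMono_Phi.lt_iff_lt.1
  rwa [hq _ (hsub (convex_Ioo _ _ hx hy hs.le ht.le hst))]

end Quantile

lemma sq_lt_of_nonneg_of_lt_convexComb {s t u v w : ℝ} (hs : 0 < s) (ht : 0 < t)
    (hst : s + t = 1) (hw : 0 ≤ w) (h : w < s * u + t * v) :
    w ^ 2 < s * u ^ 2 + t * v ^ 2 := by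
  obtain rfl : t = 1 - s := by linarith
  nlinarith [mul_nonneg (mul_pos hs ht).le (sq_nonneg (u - v))]

/-- The squared-distance objective along the boundary parameterization of `S_ε` is
strictly convex on the set where `q(λε) ≤ a` and `q(1 − (1−λ)ε) ≥ b`. Here `q` is the
standard Gaussian quantile function. -/
theorem stmt12 (ε : ℝ) (hε0 : 0 < ε) (hε : ε ≤ 1 / 2) (a b : ℝ)
    (q : ℝ → ℝ) (hq : ∀ p ∈ Set.Ioo (0 : ℝ) 1, Phi (q p) = p) :
    StrictConvexOn ℝ
      {l : ℝ | l ∈ Set.Ioo (0 : ℝ) 1 ∧ q (l * ε) ≤ a ∧ b ≤ q (1 - (1 - l) * ε)}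
      (fun l : ℝ =>
        (1 / 2) * (q (l * ε) - a) ^ 2 + (1 / 2) * (q (1 - (1 - l) * ε) - b) ^ 2) := by
  have hl : ∀ l ∈ Ioo (0 : ℝ) 1, l * ε ∈ Ioo (0 : ℝ) (1 / 2) := fun l hl =>
    ⟨mul_pos hl.1 hε0, by nlinarith [hl.2]⟩
  have hr : ∀ l ∈ Ioo (0 : ℝ) 1, (1 - l) * ε ∈ Ioo (0 : ℝ) (1 / 2) := fun l h =>
    hl (1 - l) ⟨by linarith [h.2], by linarith [h.1]⟩
  have hsub : Ioo (0 : ℝ) (1 / 2) ⊆ Ioo 0 1 := Ioo_subset_Ioo_right (by norm_num)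
  have hmono := (strictMonoOn_quantile hq).monotoneOn
  have hconc := strictConcaveOn_quantile hq
  have hconv : Convex ℝ
      {l : ℝ | l ∈ Ioo (0 : ℝ) 1 ∧ q (l * ε) ≤ a ∧ b ≤ q (1 - (1 - l) * ε)} := by
    refine OrdConnected.convex ⟨fun x hx y hy z hz => ?_⟩
    have hz' : z ∈ Ioo (0 : ℝ) 1 := ⟨hx.1.1.trans_le hz.1, hz.2.trans_lt hy.1.2⟩
    refine ⟨hz', (hmono (hsub (hl z hz')) (hsub (hl y hy.1)) ?_).trans hy.2.1, ?_⟩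
    · exact mul_le_mul_of_nonneg_right hz.2 hε0.le
    · have hxb := hx.2.2
      rw [quantile_one_sub hq (hsub (hr x hx.1))] at hxb
      rw [quantile_one_sub hq (hsub (hr z hz'))]
      have := hmono (hsub (hr z hz')) (hsub (hr x hx.1)) (by nlinarith [hz.1])
      linarith
  refine ⟨hconv, fun x hx y hy hxy s t hs ht hst => ?_⟩
  obtain ⟨hz, hza, hzb⟩ := hconv hx hy hs.le ht.le hst
  obtain ⟨hx, -, -⟩ := hx
  obtain ⟨hy, -, -⟩ := hy
  simp only [smul_eq_mul] at hz hza hzb ⊢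
  rw [quantile_one_sub hq (hsub (hr _ hz))] at hzb
  rw [quantile_one_sub hq (hsub (hr _ hz)), quantile_one_sub hq (hsub (hr x hx)),
    quantile_one_sub hq (hsub (hr y hy))]
  have h₁ := hconc.2 (hl x hx) (hl y hy)
    (fun h => hxy (mul_right_cancel₀ hε0.ne' h)) hs ht hst
  have h₂ := hconc.2 (hr x hx) (hr y hy)
    (fun h => hxy (by linarith [mul_right_cancel₀ hε0.ne' h])) hs ht hst
  simp only [smul_eq_mul] at h₁ h₂
  rw [show s * (x * ε) + t * (y * ε) = (s * x + t * y) * ε by ring] at h₁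
  rw [show s * ((1 - x) * ε) + t * ((1 - y) * ε) = (1 - (s * x + t * y)) * ε by
    linear_combination ε * hst] at h₂
  have k₁ := sq_lt_of_nonneg_of_lt_convexComb (u := a - q (x * ε)) (v := a - q (y * ε))
    hs ht hst (sub_nonneg.2 hza) (by linear_combination h₁ - a * hst)
  have k₂ := sq_lt_of_nonneg_of_lt_convexComb (u := -q ((1 - x) * ε) - b)
    (v := -q ((1 - y) * ε) - b) hs ht hst (sub_nonneg.2 hzb)
    (by linear_combination h₂ + b * hst)
  linear_combination (k₁ + k₂) / 2
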